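/- Let G be a finite group and let b ≥ 0 be an integer such that for every real element u of G of 2-power order not lying in the center Z(G), the 2-part of |C_G(u)| equals 2^b. Let U be a 2-subgroup of G with |U| ≥ 2^b. Then C_G(U) has a normal 2-complement, i.e., C_G(U) has a normal subgroup of odd order whose index is a power of 2. -/

import Mathlib

open Subgroup in
/-- If `K` is normal and contains every element of order prime to `p`, then `K` together with
any Sylow `p`-subgroup generates the group. -/
theorem Sylow.sup_eq_top_of_forall_coprime_mem {p : ℕ} [Fact p.Prime] {G : Type*} [Group G]
    [Finite G] (K : Subgroup G) [K.Normal]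
    (hK : ∀ g : G, p.Coprime (orderOf g) → g ∈ K) (S : Sylow p G) :
    K ⊔ (S : Subgroup G) = ⊤ := by
  have hq : IsPGroup p (G ⧸ K) := by
    rw [isPGroup_iff_pow_pow_eq_one]
    intro g
    obtain ⟨g, rfl⟩ := QuotientGroup.mk_surjective g
    obtain ⟨k, m, hm, hkm⟩ := Nat.exists_eq_pow_mul_and_not_dvd (orderOf_pos g).ne' p
      (Fact.out : p.Prime).ne_one
    refine ⟨k, ?_⟩
    rw [← QuotientGroup.mk_pow, QuotientGroup.eq_one_iff]
    apply hK
    rw [orderOf_pow, hkm, Nat.gcd_mul_right_left,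
      Nat.mul_div_cancel_left _ (pow_pos (Fact.out : p.Prime).pos k)]
    exact (Nat.Prime.coprime_iff_not_dvd Fact.out).2 hm
  obtain ⟨n, hn⟩ := IsPGroup.iff_card.1 hq
  rw [← Subgroup.index_eq_one]
  have h1 : (K ⊔ (S : Subgroup G)).index ∣ p ^ n := by
    rw [← hn, ← Subgroup.index_eq_card]
    exact Subgroup.index_dvd_of_le le_sup_left
  have h2 : (K ⊔ (S : Subgroup G)).index ∣ (S : Subgroup G).index :=
    Subgroup.index_dvd_of_le le_sup_right
  refine Nat.eq_one_of_dvd_coprimes ?_ h1 h2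
  exact ((Nat.Prime.coprime_iff_not_dvd Fact.out).2 S.not_dvd_index).pow_left n

open Pointwise in
/-- If `K` is normal and contains every element of order prime to `p`, then `K` acts transitively
on the Sylow `p`-subgroups. -/
theorem Sylow.exists_mem_smul_eq_of_forall_coprime_mem {p : ℕ} [Fact p.Prime] {G : Type*}
    [Group G] [Finite G] (K : Subgroup G) [K.Normal]
    (hK : ∀ g : G, p.Coprime (orderOf g) → g ∈ K) (S T : Sylow p G) :
    ∃ k ∈ K, k • S = T := by
  obtain ⟨n, rfl⟩ := MulAction.exists_smul_eq G S T
  have hn : n ∈ K ⊔ (S : Subgroup G) := by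
    rw [S.sup_eq_top_of_forall_coprime_mem K hK]; trivial
  obtain ⟨k, hk, s, hs, rfl⟩ := Subgroup.mem_sup_of_normal_left.1 hn
  refine ⟨k, hk, ?_⟩
  rw [mul_smul, Sylow.smul_eq_iff_mem_normalizer.2 (Subgroup.le_normalizer hs)]

/-- Every `p`-subgroup is centralized by the elements of order prime to `p` normalizing it. -/
def CentralizedByCoprime (p : ℕ) (G : Type*) [Group G] : Prop :=
  ∀ X : Subgroup G, IsPGroup p X → ∀ g ∈ Subgroup.normalizer (X : Set G),
    p.Coprime (orderOf g) → g ∈ Subgroup.centralizer (X : Set G)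

namespace CentralizedByCoprime

open Subgroup Pointwise commutatorElement

variable {p : ℕ} {G : Type*} [Group G]

theorem subgroup (h : CentralizedByCoprime p G) (N : Subgroup G) :
    CentralizedByCoprime p N := by
  intro X hX g hg hgp
  have h1 : (g : G) ∈ centralizer ((X.map N.subtype : Subgroup G) : Set G) := by
    refine h _ (hX.map _) _ ?_ (by rwa [orderOf_coe])
    have := le_normalizer_map N.subtype (mem_map_of_mem N.subtype hg)
    simpa using this
  rw [mem_centralizer_iff] at h1 ⊢
  intro x hx
  exact Subtype.ext (h1 x (mem_map_of_mem N.subtype hx))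

theorem mem_centralizer_subgroupOf (h : CentralizedByCoprime p G) {D : Subgroup G}
    (hD : IsPGroup p D) (g : normalizer (D : Set G)) (hg : p.Coprime (orderOf g)) :
    g ∈ (centralizer (D : Set G)).subgroupOf (normalizer (D : Set G)) :=
  mem_subgroupOf.2 <| h D hD g g.2 (by rwa [orderOf_coe])

variable [Fact p.Prime] [Finite G]

/-- Sylow `p`-subgroups containing `D` are conjugate under the centralizer of `D`. -/
theorem exists_mem_centralizer_smul_eq (h : CentralizedByCoprime p G) (D : Subgroup G) :
    ∀ S T : Sylow p G, D ≤ S → D ≤ T → ∃ c ∈ centralizer (D : Set G), c • S = T := by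
  induction D using WellFoundedGT.induction with
  | ind D ih =>
  intro S T hS hT
  have hD : IsPGroup p D := S.2.to_le hS
  rcases hS.eq_or_lt with rfl | hS'
  · exact ⟨1, one_mem _, by rw [one_smul]; exact Sylow.ext (S.3 T.2 hT).symm⟩
  rcases hT.eq_or_lt with rfl | hT'
  · exact ⟨1, one_mem _, by rw [one_smul]; exact Sylow.ext (T.3 S.2 hS)⟩
  have key : ∀ R : Sylow p G, D < R →
      D < (R : Subgroup G) ⊓ normalizer (D : Set G) := by
    intro R hR
    have hnil := R.2.isNilpotent
    have hlt : D.subgroupOf R < ⊤ :=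
      lt_top_iff_ne_top.2 fun h' => hR.not_ge (subgroupOf_eq_top.1 h')
    obtain ⟨x, hx, hxD⟩ :=
      SetLike.exists_of_lt (Group.normalizerCondition_of_isNilpotent _ hlt)
    refine lt_of_le_of_ne (le_inf hR.le le_normalizer) fun h' => hxD ?_
    rw [mem_subgroupOf, h']
    refine ⟨x.2, mem_normalizer_iff.2 fun d => ?_⟩
    have hd : ∀ d : R, (d : G) ∈ D ↔ (x * d * x⁻¹ : G) ∈ D := mem_normalizer_iff.1 hx
    refine ⟨fun h1 => (hd ⟨d, hR.le h1⟩).1 h1, fun h1 => (hd ⟨d, ?_⟩).2 h1⟩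
    have h2 := mul_mem (mul_mem (inv_mem x.2) (hR.le h1)) x.2
    simpa [mul_assoc] using! h2
  obtain ⟨P₁, hP₁⟩ := IsPGroup.exists_le_sylow
    (P := ((S : Subgroup G) ⊓ normalizer (D : Set G)).subgroupOf (normalizer (D : Set G)))
    ((S.2.to_le inf_le_left).comap_subtype)
  obtain ⟨Q₁, hQ₁⟩ := IsPGroup.exists_le_sylow
    (P := ((T : Subgroup G) ⊓ normalizer (D : Set G)).subgroupOf (normalizer (D : Set G)))
    ((T.2.to_le inf_le_left).comap_subtype)
  obtain ⟨S₁, hS₁⟩ := IsPGroup.exists_le_sylow (P₁.2.map (normalizer (D : Set G)).subtype)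
  obtain ⟨c, hc, hcPQ⟩ := P₁.exists_mem_smul_eq_of_forall_coprime_mem _
    (h.mem_centralizer_subgroupOf hD) Q₁
  obtain ⟨a, ha, haS⟩ := ih _ (key S hS') S S₁ inf_le_left <| by
    intro x hx
    exact hS₁ (mem_map.2 ⟨⟨x, hx.2⟩, hP₁ (mem_subgroupOf.2 hx), rfl⟩)
  obtain ⟨d, hd, hdT⟩ := ih _ (key T hT') ((c : G) • S₁) T (by
    intro x hx
    have h1 : (⟨x, hx.2⟩ : normalizer (D : Set G)) ∈ (c • P₁ : Sylow p _) := by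
      rw [hcPQ]; exact hQ₁ (mem_subgroupOf.2 hx)
    rw [← SetLike.mem_coe, Sylow.coe_smul, Set.mem_smul_set] at h1
    obtain ⟨y, hy, hyx⟩ := h1
    rw [← SetLike.mem_coe, Sylow.coe_coe, Sylow.coe_smul, Set.mem_smul_set]
    refine ⟨y, hS₁ (mem_map_of_mem _ hy), ?_⟩
    simpa using congrArg Subtype.val hyx) inf_le_left
  refine ⟨d * c * a, mul_mem (mul_mem ?_ (mem_subgroupOf.1 hc)) ?_, ?_⟩
  · exact centralizer_le (key T hT').le hd
  · exact centralizer_le (key S hS').le ha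
  · rw [mul_smul, mul_smul, haS, hdT]

/-- A Sylow `p`-subgroup controls its own fusion. -/
theorem exists_conj_eq (h : CentralizedByCoprime p G) (P : Sylow p G) {x u : G}
    (hx : x ∈ P) (hu : u * x * u⁻¹ ∈ P) : ∃ y ∈ P, u * x * u⁻¹ = y * x * y⁻¹ := by
  obtain ⟨c, hc, hcP⟩ := h.exists_mem_centralizer_smul_eq (zpowers x) P (u⁻¹ • P)
    (zpowers_le.2 hx) (zpowers_le.2 <| by
      rw [← SetLike.mem_coe, Sylow.coe_coe, Sylow.coe_smul, Set.mem_smul_set]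
      exact ⟨_, hu, by simp [mul_assoc]⟩)
  have hn : u * c ∈ normalizer (P : Set G) := by
    rw [← Sylow.smul_eq_iff_mem_normalizer, mul_smul, hcP, smul_inv_smul]
  have hn' : (⟨u * c, hn⟩ : normalizer (P : Set G)) ∈
      (centralizer (P : Set G)).subgroupOf (normalizer (P : Set G)) ⊔
        (P.subtype le_normalizer : Subgroup (normalizer (P : Set G))) :=
    Sylow.sup_eq_top_of_forall_coprime_mem _ (h.mem_centralizer_subgroupOf P.2) _ ▸ mem_top _
  obtain ⟨y, hy, k, hk, hyk⟩ := mem_sup_of_normal_right.1 (by rwa [sup_comm] at hn')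
  have hyk' : (y : G) * k = u * c := congrArg Subtype.val hyk
  have hxc : x * c = c * x := mem_centralizer_iff.1 hc x (mem_zpowers x)
  have hxk : x * k = k * x := mem_centralizer_iff.1 (mem_subgroupOf.1 hk) x hx
  refine ⟨y, hy, ?_⟩
  calc u * x * u⁻¹ = u * (x * c) * c⁻¹ * u⁻¹ := by group
    _ = (u * c) * x * (u * c)⁻¹ := by rw [hxc]; group
    _ = y * (k * x) * (k : G)⁻¹ * (y : G)⁻¹ := by rw [← hyk']; group
    _ = y * x * (y : G)⁻¹ := by rw [← hxk]; group

theorem focalSubgroup_le (h : CentralizedByCoprime p G) (P : Sylow p G) :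
    (P : Subgroup G).focalSubgroup ≤ ⁅(P : Subgroup G), (P : Subgroup G)⁆ := by
  rw [focalSubgroup_def, closure_le]
  rintro g ⟨hg, x, hx, u, rfl⟩
  rw [commutatorElement_def] at hg
  have h1 : u * x⁻¹ * u⁻¹ ∈ (P : Subgroup G) := by
    simpa [mul_assoc] using mul_mem (inv_mem hx) hg
  obtain ⟨y, hy, hyu⟩ := h.exists_conj_eq P (inv_mem hx) h1
  have : ⁅x, u⁆ = ⁅x, y⁆ := by
    rw [commutatorElement_def, commutatorElement_def, mul_assoc, mul_assoc, ← mul_assoc u, hyu]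
    group
  rw [this]
  exact commutator_mem_commutator hx hy

theorem ker_transferFocal_ne_top (h : CentralizedByCoprime p G) (P : Sylow p G)
    (hP : (P : Subgroup G) ≠ ⊥) : (P : Subgroup G).transferFocal.ker ≠ ⊤ := by
  intro htop
  have h1 := ker_transferFocal_inf_eq_focalSubgroup P
  rw [htop, top_inf_eq] at h1
  have hnil := P.2.isNilpotent
  have : Nontrivial P := (nontrivial_iff_ne_bot _).2 hP
  refine (Group.IsSolvable.commutator_lt_top_of_nontrivial P).not_ge ?_
  rw [← map_subtype_le_map_subtype, map_subtype_commutator, ← MonoidHom.range_eq_map,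
    range_subtype]
  exact h1.le.trans (h.focalSubgroup_le P)

end CentralizedByCoprime

/-- The **normal `p`-complement theorem** of Frobenius. -/
theorem CentralizedByCoprime.exists_normal_complement {p : ℕ} [Fact p.Prime] {G : Type*}
    [Group G] [Finite G] (h : CentralizedByCoprime p G) :
    ∃ M : Subgroup G, M.Normal ∧ p.Coprime (Nat.card M) ∧ ∃ k : ℕ, M.index = p ^ k := by
  induction hn : Nat.card G using Nat.strong_induction_on generalizing G with
  | _ n ih =>
  obtain ⟨P⟩ := (inferInstance : Nonempty (Sylow p G))
  by_cases hP : (P : Subgroup G) = ⊥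
  · refine ⟨⊤, inferInstance, ?_, 0, by simp⟩
    have := P.not_dvd_index
    rw [hP, Subgroup.index_bot] at this
    rw [Subgroup.card_top]
    exact (Nat.Prime.coprime_iff_not_dvd Fact.out).2 this
  set N := (P : Subgroup G).transferFocal.ker with hN
  obtain ⟨j, hj⟩ : ∃ j : ℕ, N.index = p ^ j := by
    rw [hN, Subgroup.index_ker]
    exact IsPGroup.iff_card.1 ((P.2.to_quotient _).to_subgroup _)
  have hlt : Nat.card N < n := hn ▸ lt_of_le_of_ne N.card_le_card_group fun h' =>
    h.ker_transferFocal_ne_top P hP (N.eq_top_of_card_eq h')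
  obtain ⟨M, hM, hMp, k, hk⟩ := ih _ hlt (h.subgroup N) rfl
  refine ⟨M.map N.subtype, ⟨?_⟩, ?_, k + j, ?_⟩
  · rintro _ ⟨m, hm, rfl⟩ g
    refine ⟨MulAut.conjNormal g m, ?_, MulAut.conjNormal_apply g m⟩
    have hq : IsPGroup p (N ⧸ M) := IsPGroup.of_card (M.index_eq_card.symm.trans hk)
    obtain ⟨i, hi⟩ := IsPGroup.iff_orderOf.1 hq (MulAut.conjNormal g m : N)
    rw [SetLike.mem_coe, ← QuotientGroup.eq_one_iff, ← orderOf_eq_one_iff]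
    refine Nat.eq_one_of_dvd_coprimes (hMp.pow_left i) hi.dvd ?_
    refine (orderOf_map_dvd (QuotientGroup.mk' M) _).trans ?_
    rw [MulEquiv.orderOf_eq]
    exact Subgroup.orderOf_dvd_natCard M hm
  · rwa [Subgroup.card_map_of_injective N.subtype_injective]
  · rw [Subgroup.index_map_subtype, hk, hj, pow_add]

/-- If the real 2-elements of a finite group are central, then every element of odd order
normalizing a 2-subgroup centralizes it. -/
theorem centralizedByCoprime_two_of_real_mem_center {G : Type*} [Group G] [Finite G]
    (h : ∀ u : G, IsConj u u⁻¹ → (∃ n : ℕ, orderOf u = 2 ^ n) → u ∈ Subgroup.center G) :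
    CentralizedByCoprime 2 G := by
  intro X hX g hg hg2
  have key : ∀ n : ℕ, ∀ x ∈ X, x ^ 2 ^ n = 1 → Commute g x := by
    intro n
    induction n with
    | zero => intro x _ hx; simp_all
    | succ n ih =>
      intro x hx hxn
      have h2 : Commute g (x ^ 2) := ih _ (pow_mem hx 2) (by rw [← pow_mul, ← pow_succ', hxn])
      have hy : g * x * g⁻¹ ∈ X := (Subgroup.mem_normalizer_iff.1 hg x).1 hx
      obtain ⟨w, hw⟩ : ∃ w, x⁻¹ * (g * x * g⁻¹) = w := ⟨_, rfl⟩
      have hwX : w ∈ X := hw ▸ mul_mem (inv_mem hx) hy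
      have hgx : g * x * g⁻¹ = x * w := by rw [← hw]; group
      obtain ⟨m, hm⟩ := IsPGroup.iff_orderOf.1 hX ⟨w, hwX⟩
      rw [Subgroup.orderOf_mk] at hm
      have hsq : x * w * (x * w) = x * x := by
        rw [← hgx, ← pow_two, conj_pow, h2.eq, mul_inv_cancel_right, pow_two]
      have hreal : IsConj w w⁻¹ := by
        rw [isConj_iff]
        refine ⟨x⁻¹, ?_⟩
        rw [mul_assoc, mul_right_inj, ← mul_assoc] at hsq
        rw [inv_inv, eq_inv_iff_mul_eq_one, mul_assoc, mul_assoc, ← mul_assoc w, hsq,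
          inv_mul_cancel]
      have hc := h w hreal ⟨m, hm⟩
      have hpow : ∀ k : ℕ, g ^ k * x * (g ^ k)⁻¹ = x * w ^ k := by
        intro k
        induction k with
        | zero => simp
        | succ k ihk =>
          have hgw : g * w ^ k * g⁻¹ = w ^ k := by
            rw [Subgroup.mem_center_iff.1 (pow_mem hc k) g, mul_inv_cancel_right]
          calc g ^ (k + 1) * x * (g ^ (k + 1))⁻¹ = g * (g ^ k * x * (g ^ k)⁻¹) * g⁻¹ := by
                rw [pow_succ']; group
            _ = (g * x * g⁻¹) * (g * w ^ k * g⁻¹) := by rw [ihk]; group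
            _ = x * w ^ (k + 1) := by rw [hgx, hgw, pow_succ', mul_assoc]
      have hw1 : w ^ orderOf g = 1 := by
        simpa [pow_orderOf_eq_one] using (hpow (orderOf g)).symm
      have : orderOf w = 1 :=
        Nat.eq_one_of_dvd_coprimes (hg2.pow_left m) hm.dvd (orderOf_dvd_of_pow_eq_one hw1)
      rw [orderOf_eq_one_iff] at this
      rw [this, mul_one, mul_inv_eq_iff_eq_mul] at hgx
      exact hgx
  rw [Subgroup.mem_centralizer_iff]
  intro x hx
  obtain ⟨n, hn⟩ := isPGroup_iff_pow_pow_eq_one.1 hX ⟨x, hx⟩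
  exact (key n x hx (by simpa using congrArg Subtype.val hn)).eq.symm

/-- Suppose every real element of 2-power order of a finite group `G` not lying in the
center has centralizer whose order has 2-part `2 ^ b`. If `U` is a 2-subgroup of `G`
with `|U| ≥ 2 ^ b`, then `C_G(U)` has a normal 2-complement. -/
theorem stmt_17 {G : Type*} [Group G] [Finite G] (b : ℕ)
    (h : ∀ u : G, IsConj u u⁻¹ → (∃ n : ℕ, orderOf u = 2 ^ n) →
      u ∉ Subgroup.center G →
      (Nat.card (Subgroup.centralizer {u})).factorization 2 = b)
    (U : Subgroup G) (hU : ∃ k : ℕ, Nat.card U = 2 ^ k) (hUb : 2 ^ b ≤ Nat.card U) :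
    ∃ M : Subgroup (Subgroup.centralizer (U : Set G)), M.Normal ∧
      Odd (Nat.card M) ∧ ∃ k : ℕ, M.index = 2 ^ k := by
  have hU2 : IsPGroup 2 U := IsPGroup.iff_card.2 hU
  suffices hC : CentralizedByCoprime 2 (Subgroup.centralizer (U : Set G)) by
    obtain ⟨M, hM, hM2, k, hk⟩ := hC.exists_normal_complement
    exact ⟨M, hM, Nat.coprime_two_left.1 hM2, k, hk⟩
  apply centralizedByCoprime_two_of_real_mem_center
  rintro ⟨x, hx⟩ hreal hord
  rw [Subgroup.orderOf_mk] at hord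
  rw [Subgroup.mem_center_iff]
  rintro ⟨y, hy⟩
  rw [Subtype.ext_iff]
  by_cases hxc : x ∈ Subgroup.center G
  · exact Subgroup.mem_center_iff.1 hxc y
  have hb := h x ((Subgroup.subtype _).map_isConj hreal) hord hxc
  suffices hxU : x ∈ U from (Subgroup.mem_centralizer_iff.1 hy x hxU).symm
  obtain ⟨n, hn⟩ := hord
  have hle : U ≤ Subgroup.centralizer {x} := fun u hu =>
    Subgroup.mem_centralizer_singleton_iff.2 (Subgroup.mem_centralizer_iff.1 hx u hu)
  have hxx : x ∈ Subgroup.centralizer {x} := Subgroup.mem_centralizer_singleton_iff.2 rfl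
  have hsup : IsPGroup 2 (U ⊔ Subgroup.zpowers x : Subgroup G) := by
    refine hU2.to_sup_of_normal_left' (IsPGroup.of_card (n := n) (by rw [Nat.card_zpowers, hn])) ?_
    exact Subgroup.zpowers_le.2 (Subgroup.centralizer_le_normalizer _ hx)
  obtain ⟨m, hm⟩ := IsPGroup.iff_card.1 hsup
  have hdvd : 2 ^ m ∣ Nat.card (Subgroup.centralizer {x}) :=
    hm ▸ Subgroup.card_dvd_of_le (sup_le hle (Subgroup.zpowers_le.2 hxx))
  have hmb : m ≤ b :=
    hb ▸ (Nat.prime_two.pow_dvd_iff_le_factorization Nat.card_pos.ne').1 hdvd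
  have hcard : Nat.card (U ⊔ Subgroup.zpowers x : Subgroup G) ≤ Nat.card U :=
    hm ▸ (Nat.pow_le_pow_right two_pos hmb).trans hUb
  rw [Subgroup.eq_of_le_of_card_ge le_sup_left hcard]
  exact Subgroup.mem_sup_right (Subgroup.mem_zpowers x)
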